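/- Let f : 𝔹ⁿ → 𝔹ⁿ have no positive loop at v in G(f). For each x ∈ 𝔹ⁿ such that x ≠ R^0(x) or x ≠ R^1(x), there is a transition in AD(f) from x to R^0(x) or to R^1(x), and the set {R^0(x), R^1(x)} is strongly connected in AD(f). -/

import Mathlib

open Function Relation

/-- Flip coordinate `i` of a Boolean state. -/
def flipc {V : Type*} [DecidableEq V] (x : V → Bool) (i : V) : V → Bool :=
  Function.update x i (!(x i))

/-- Transition relation of the asynchronous dynamics `AD f`. -/
def Step {V : Type*} [DecidableEq V] (f : (V → Bool) → V → Bool) (x y : V → Bool) : Prop :=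
  ∃ i, f x i ≠ x i ∧ y = flipc x i

/-- Trap set of the asynchronous dynamics. -/
def IsTrap {V : Type*} [DecidableEq V] (f : (V → Bool) → V → Bool) (T : Set (V → Bool)) : Prop :=
  ∀ x ∈ T, ∀ y, Step f x y → y ∈ T

/-- Attractor: minimal nonempty trap set. -/
def IsAttractor {V : Type*} [DecidableEq V] (f : (V → Bool) → V → Bool) (A : Set (V → Bool)) : Prop :=
  A.Nonempty ∧ IsTrap f A ∧ ∀ B ⊆ A, B.Nonempty → IsTrap f B → B = A

/-- `R(x)`: replace coordinate `v` by `f_v(x)`. -/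
def Rv {n : ℕ} (f : (Fin n → Bool) → Fin n → Bool) (v : Fin n) (x : Fin n → Bool) : Fin n → Bool :=
  Function.update x v (f x v)

/-- `R^a(x)`: replace coordinate `v` by `f_v(x^{v=a})`. -/
def Ra {n : ℕ} (f : (Fin n → Bool) → Fin n → Bool) (v : Fin n) (a : Bool) (x : Fin n → Bool) :
    Fin n → Bool :=
  Function.update x v (f (Function.update x v a) v)

/-- Projection forgetting coordinate `v`. -/
def proj {n : ℕ} (v : Fin n) (x : Fin n → Bool) : {i : Fin n // i ≠ v} → Bool :=
  fun i => x i.1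

/-- No loop at `v` in the interaction graph. -/
def NoLoop {n : ℕ} (f : (Fin n → Bool) → Fin n → Bool) (v : Fin n) : Prop :=
  ∀ x, f x v = f (flipc x v) v

/-- No positive loop at `v` in the interaction graph. -/
def NoPosLoop {n : ℕ} (f : (Fin n → Bool) → Fin n → Bool) (v : Fin n) : Prop :=
  ∀ x, f (Function.update x v true) v = true → f (Function.update x v false) v = true

/-- Boolean value as an integer. -/
def bint (b : Bool) : ℤ := if b then 1 else 0

/-- `G(f)` has an edge `j → i` of sign `s`. -/
def HasEdge {V : Type*} [DecidableEq V] (f : (V → Bool) → V → Bool) (j i : V) (s : ℤ) : Prop :=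
  ∃ x, (bint (f (flipc x j) i) - bint (f x i)) * (bint (!(x j)) - bint (x j)) = s

theorem step_update_aux {n : ℕ} (f : (Fin n → Bool) → Fin n → Bool) (v : Fin n)
    (x : Fin n → Bool) (a b : Bool) (hab : a ≠ b)
    (h : f (Function.update x v a) v = b) :
    Step f (Function.update x v a) (Function.update x v b) := by
  refine ⟨v, ?_, ?_⟩
  · rw [h, Function.update_self]; exact hab.symm
  · cases a <;> cases b <;> simp_all [flipc]

theorem stmt6 (n : ℕ) (f : (Fin n → Bool) → Fin n → Bool) (v : Fin n)
    (hv : NoPosLoop f v) (x : Fin n → Bool)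
    (hx : x ≠ Ra f v false x ∨ x ≠ Ra f v true x) :
    (Step f x (Ra f v false x) ∨ Step f x (Ra f v true x)) ∧
    Relation.ReflTransGen (Step f) (Ra f v false x) (Ra f v true x) ∧
    Relation.ReflTransGen (Step f) (Ra f v true x) (Ra f v false x) := by
  have hv' := hv x
  have key : ∀ c, x ≠ Function.update x v c → x = Function.update x v (!c) := by
    intro c hc
    have h : x v = !c := by
      by_contra h
      apply hc
      have h2 : c = x v := by revert h; cases c <;> cases x v <;> simp
      rw [h2, Function.update_eq_self]
    rw [← h, Function.update_eq_self]
  have h01 := step_update_aux f v x false true (by simp)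
  have h10 := step_update_aux f v x true false (by simp)
  unfold Ra at *
  generalize f (Function.update x v false) v = q at *
  generalize f (Function.update x v true) v = p at *
  cases p <;> cases q
  · -- both values are `false`
    have h := key false (hx.elim id id)
    have h3 := h10 rfl
    rw [Bool.not_false] at h
    rw [← h] at h3
    exact ⟨Or.inl h3, .refl, .refl⟩
  · -- negative loop
    have h3 := h10 rfl
    have h4 := h01 rfl
    refine ⟨?_, .single h3, .single h4⟩
    by_cases hc : x = Function.update x v true
    · rw [← hc] at h3
      exact Or.inr h3
    · have h := key true hc
      rw [Bool.not_true] at h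
      rw [← h] at h4
      exact Or.inl h4
  · exact absurd (hv' rfl) (by simp)
  · -- both values are `true`
    have h := key true (hx.elim id id)
    have h3 := h01 rfl
    rw [Bool.not_true] at h
    rw [← h] at h3
    exact ⟨Or.inl h3, .refl, .refl⟩
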